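/- Let L be a bounded distributive lattice, n ≥ 1, and f : L^n → L. Then f is a Sugeno integral (i.e., f = S_μ for some L-valued fuzzy measure μ on [n]) if and only if f is an idempotent weighted lattice polynomial function, i.e., a weighted lattice polynomial function satisfying f(x, x, …, x) = x for all x ∈ L. -/

import Mathlib

/-- Weighted lattice polynomial (w.l.p.) functions from `L^n` to `L`: the smallest
class containing all coordinate projections and all constant functions, and closed
under pointwise `⊓` and `⊔`. -/
inductive IsWLP {L : Type*} [Lattice L] {n : ℕ} : ((Fin n → L) → L) → Prop
  | proj (k : Fin n) : IsWLP (fun x => x k)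
  | const (c : L) : IsWLP (fun _ => c)
  | inf {p q : (Fin n → L) → L} : IsWLP p → IsWLP q → IsWLP (fun x => p x ⊓ q x)
  | sup {p q : (Fin n → L) → L} : IsWLP p → IsWLP q → IsWLP (fun x => p x ⊔ q x)

/-- The characteristic vector `e_S` of `S ⊆ [n]`: its `i`-th component is `1` (top)
if `i ∈ S` and `0` (bottom) otherwise. -/
def charVec (L : Type*) [Lattice L] [BoundedOrder L] {n : ℕ} (S : Finset (Fin n)) :
    Fin n → L :=
  fun i => if i ∈ S then ⊤ else ⊥

namespace IsWLP

variable {L : Type*} {n : ℕ}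

theorem monotone [Lattice L] {f : (Fin n → L) → L} (hf : IsWLP f) : Monotone f := by
  induction hf with
  | proj k => exact fun _ _ h => h k
  | const c => exact fun _ _ _ => le_rfl
  | inf _ _ hp hq => exact fun _ _ h => inf_le_inf (hp h) (hq h)
  | sup _ _ hp hq => exact fun _ _ h => sup_le_sup (hp h) (hq h)

theorem finset_sup [Lattice L] [OrderBot L] {ι : Type*} (s : Finset ι)
    {g : ι → (Fin n → L) → L} (hg : ∀ i, IsWLP (g i)) :
    IsWLP (fun x => s.sup (fun i => g i x)) := by
  classical
  induction s using Finset.induction_on with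
  | empty => simpa only [Finset.sup_empty] using IsWLP.const ⊥
  | insert a s _ ih => simpa only [Finset.sup_insert] using IsWLP.sup (hg a) ih

theorem finset_inf [Lattice L] [OrderTop L] {ι : Type*} (s : Finset ι)
    {g : ι → (Fin n → L) → L} (hg : ∀ i, IsWLP (g i)) :
    IsWLP (fun x => s.inf (fun i => g i x)) := by
  classical
  induction s using Finset.induction_on with
  | empty => simpa only [Finset.inf_empty] using IsWLP.const ⊤
  | insert a s _ ih => simpa only [Finset.inf_insert] using IsWLP.inf (hg a) ih

end IsWLP

theorem charVec_mono (L : Type*) [Lattice L] [BoundedOrder L] {n : ℕ} :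
    Monotone (charVec L (n := n)) := by
  intro S T h i
  by_cases hi : i ∈ S
  · simp [charVec, hi, h hi]
  · simp [charVec, hi]

/-- Disjunctive normal form of a weighted lattice polynomial function: it is determined by its
values on characteristic vectors. -/
theorem IsWLP.eq_sup_charVec {L : Type*} [DistribLattice L] [BoundedOrder L] {n : ℕ}
    {f : (Fin n → L) → L} (hf : IsWLP f) (x : Fin n → L) :
    f x = Finset.univ.sup (fun S : Finset (Fin n) => f (charVec L S) ⊓ S.inf x) := by
  induction hf with
  | proj k =>
    apply le_antisymm
    · refine le_trans ?_ (Finset.le_sup (Finset.mem_univ {k}))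
      simp [charVec]
    · refine Finset.sup_le fun S _ => ?_
      by_cases hk : k ∈ S
      · exact inf_le_right.trans (Finset.inf_le hk)
      · simp [charVec, hk]
  | const c =>
    apply le_antisymm
    · refine le_trans ?_ (Finset.le_sup (Finset.mem_univ ∅))
      simp
    · exact Finset.sup_le fun S _ => inf_le_left
  | @inf p q hp hq ihp ihq =>
    apply le_antisymm
    · simp only [ihp, ihq, Finset.sup_inf_sup]
      refine Finset.sup_le fun ST _ => ?_
      refine le_trans ?_ (Finset.le_sup (Finset.mem_univ (ST.1 ∪ ST.2)))
      rw [Finset.inf_union, inf_inf_inf_comm]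
      exact inf_le_inf_right _ (inf_le_inf
        (hp.monotone (charVec_mono L Finset.subset_union_left))
        (hq.monotone (charVec_mono L Finset.subset_union_right)))
    · simp only [ihp, ihq]
      exact le_inf (Finset.sup_mono_fun fun S _ => inf_le_inf_right _ inf_le_left)
        (Finset.sup_mono_fun fun S _ => inf_le_inf_right _ inf_le_right)
  | sup _ _ ihp ihq =>
    simp only [ihp, ihq, ← Finset.sup_sup, inf_sup_right, Pi.sup_def]

/-- A function `f : L^n → L` is a Sugeno integral (with respect to some `L`-valued
fuzzy measure on `[n]`) iff it is an idempotent w.l.p. function. -/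
theorem sugeno_integral_iff_idempotent_wlp
    {L : Type*} [DistribLattice L] [BoundedOrder L] {n : ℕ} (hn : 1 ≤ n)
    (f : (Fin n → L) → L) :
    (∃ μ : Finset (Fin n) → L,
        (∀ S T : Finset (Fin n), S ⊆ T → μ S ≤ μ T) ∧
        μ ∅ = ⊥ ∧ μ Finset.univ = ⊤ ∧
        ∀ x : Fin n → L,
          f x = Finset.univ.sup (fun S : Finset (Fin n) => μ S ⊓ S.inf x)) ↔
      (IsWLP f ∧ ∀ c : L, f (fun _ => c) = c) := by
  constructor
  · rintro ⟨μ, -, hbot, htop, hf⟩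
    refine ⟨?_, fun c => ?_⟩
    · rw [funext hf]
      exact IsWLP.finset_sup _ fun S =>
        IsWLP.inf (IsWLP.const (μ S)) (IsWLP.finset_inf S IsWLP.proj)
    · rw [hf]
      apply le_antisymm
      · refine Finset.sup_le fun S _ => ?_
        rcases S.eq_empty_or_nonempty with rfl | ⟨i, hi⟩
        · simp [hbot]
        · exact inf_le_right.trans (Finset.inf_le (f := fun _ => c) hi)
      · refine le_trans ?_ (Finset.le_sup (Finset.mem_univ Finset.univ))
        rw [htop, top_inf_eq]
        exact Finset.le_inf fun _ _ => le_rfl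
  · rintro ⟨hw, hid⟩
    refine ⟨fun S => f (charVec L S), fun S T h => hw.monotone (charVec_mono L h), ?_, ?_,
      hw.eq_sup_charVec⟩
    · exact (congrArg f (funext fun i => by simp [charVec])).trans (hid ⊥)
    · exact (congrArg f (funext fun i => by simp [charVec])).trans (hid ⊤)
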